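/- Fix an integer g ≥ 1. Let C be a function from partitions to ℚ that vanishes on every partition λ unless all parts of λ are ≥ 2 and |λ| − max(λ) ≤ 3g−3, and for each n ≥ 1 define A_n := Σ_{λ : |λ| ≤ 3g−3+n} C(λ)·e_λ(x_1,…,x_n)·e_1(x_1,…,x_n)^{3g−3+n−|λ|} in ℚ[x_1,…,x_n]. Suppose the dilaton equation holds: for every n ≥ 1, (∂A_{n+1}/∂x_{n+1}) evaluated at x_{n+1} = 0 equals (2g−2+n)·A_n. Then C satisfies the dilaton recursion: for every partition λ with all parts ≥ 2, Σ_{a ∈ distinct parts of λ} (m_{a+1}(λ)+1)·C(λ∖{a} ∪ {a+1}) + (m_2(λ)+1)·C(λ ∪ {2}) + (g−|λ|)·C(λ) = 0, where λ∖{a} ∪ {a+1} denotes λ with one part equal to a replaced by a+1, and λ ∪ {2} denotes λ with one extra part equal to 2 added. -/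

import Mathlib

open MvPolynomial

/-- `e_λ = ∏_{a ∈ λ} e_a`, the product of elementary symmetric polynomials
indexed by the parts of the partition `p` (a multiset of positive integers). -/
noncomputable def esymmProd (n : ℕ) (p : Multiset ℕ) : MvPolynomial (Fin n) ℚ :=
  (p.map (esymm (Fin n) ℚ)).prod

/-- The amplitude `A_n = Σ_{λ : |λ| ≤ 3g-3+n} C(λ) · e_λ · e_1 ^ (3g-3+n-|λ|)`. -/
noncomputable def amplitudeTrunc (g n : ℕ) (C : Multiset ℕ → ℚ) :
    MvPolynomial (Fin n) ℚ :=
  ∑ᶠ p : Multiset ℕ,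
    if p.sum + 3 ≤ 3 * g + n then
      C p • (esymmProd n p * (esymm (Fin n) ℚ 1) ^ (3 * g + n - 3 - p.sum))
    else 0

/-- Setting the last variable `x_{n+1}` to zero. -/
noncomputable def setLastZero (n : ℕ) :
    MvPolynomial (Fin (n + 1)) ℚ →ₐ[ℚ] MvPolynomial (Fin n) ℚ :=
  aeval (Fin.lastCases 0 X)

theorem Multiset.esymm_cons_succ {R : Type*} [CommSemiring R] (a : R) (s : Multiset R) (k : ℕ) :
    (a ::ₘ s).esymm (k + 1) = s.esymm (k + 1) + a * s.esymm k := by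
  simp [Multiset.esymm, Multiset.powersetCard_cons, Multiset.sum_map_mul_left]

theorem esymm_fin_succ (n k : ℕ) :
    esymm (Fin (n + 1)) ℚ (k + 1) = rename Fin.castSucc (esymm (Fin n) ℚ (k + 1)) +
      X (Fin.last n) * rename Fin.castSucc (esymm (Fin n) ℚ k) := by
  have h : ((Finset.univ : Finset (Fin (n + 1))).val.map X : Multiset (MvPolynomial _ ℚ)) =
      X (Fin.last n) ::ₘ (Finset.univ : Finset (Fin n)).val.map (X ∘ Fin.castSucc) := by
    rw [Fin.univ_castSuccEmb, Finset.cons_val, Multiset.map_cons, Finset.map_val,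
      Multiset.map_map]
    rfl
  have hrename : (rename Fin.castSucc : MvPolynomial (Fin n) ℚ →ₐ[ℚ] _) =
      aeval (X ∘ Fin.castSucc) := by
    ext1 i
    simp
  rw [esymm_eq_multiset_esymm, h, Multiset.esymm_cons_succ, hrename,
    aeval_esymm_eq_multiset_esymm, aeval_esymm_eq_multiset_esymm]

theorem setLastZero_rename (n : ℕ) (q : MvPolynomial (Fin n) ℚ) :
    setLastZero n (rename Fin.castSucc q) = q := by
  rw [setLastZero, aeval_rename]
  have h : (Fin.lastCases 0 X : Fin (n + 1) → MvPolynomial (Fin n) ℚ) ∘ Fin.castSucc = X := by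
    funext i
    simp
  rw [h, aeval_X_left_apply]

theorem pderiv_last_rename (n : ℕ) (q : MvPolynomial (Fin n) ℚ) :
    pderiv (Fin.last n) (rename Fin.castSucc q) = 0 := by
  classical
  apply pderiv_eq_zero_of_notMem_vars
  intro h
  obtain ⟨i, -, hi⟩ := Finset.mem_image.mp (vars_rename _ _ h)
  exact (Fin.castSucc_lt_last i).ne hi

theorem setLastZero_X_last (n : ℕ) : setLastZero n (X (Fin.last n)) = 0 := by
  simp [setLastZero]

theorem setLastZero_esymm_succ (n k : ℕ) :
    setLastZero n (esymm (Fin (n + 1)) ℚ (k + 1)) = esymm (Fin n) ℚ (k + 1) := by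
  simp [esymm_fin_succ, setLastZero_rename, setLastZero_X_last]

theorem setLastZero_pderiv_esymm_succ (n k : ℕ) :
    setLastZero n (pderiv (Fin.last n) (esymm (Fin (n + 1)) ℚ (k + 1))) = esymm (Fin n) ℚ k := by
  simp [esymm_fin_succ, pderiv_last_rename, setLastZero_rename]

theorem esymm_fin_eq_zero {n k : ℕ} (h : n < k) : esymm (Fin n) ℚ k = 0 := by
  rw [esymm, Finset.powersetCard_eq_empty.mpr (by simpa using h), Finset.sum_empty]

/-- Evaluation of a polynomial in formal variables `X k` at the elementary symmetric polynomials
`e_k` in `n` variables (with `X 0` sent to `0`). -/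
noncomputable def esymmEval (n : ℕ) : MvPolynomial ℕ ℚ →ₐ[ℚ] MvPolynomial (Fin n) ℚ :=
  aeval fun k => if k = 0 then 0 else esymm (Fin n) ℚ k

/-- The derivation `X 1 ↦ 1`, `X (a + 1) ↦ X a` for `1 ≤ a ≤ n`, zero on the other variables. -/
noncomputable def lowerDerivation (n : ℕ) :
    Derivation ℚ (MvPolynomial ℕ ℚ) (MvPolynomial ℕ ℚ) :=
  pderiv 1 + ∑ a ∈ Finset.Icc 1 n, (X a : MvPolynomial ℕ ℚ) • pderiv (a + 1)

theorem lowerDerivation_apply (n : ℕ) (F : MvPolynomial ℕ ℚ) :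
    lowerDerivation n F = pderiv 1 F + ∑ a ∈ Finset.Icc 1 n, X a * pderiv (a + 1) F := by
  have h := map_sum Derivation.coeFnAddMonoidHom
    (fun a => (X a : MvPolynomial ℕ ℚ) • pderiv (R := ℚ) (a + 1)) (Finset.Icc 1 n)
  rw [lowerDerivation, Derivation.add_apply]
  congr 1
  exact (congr_fun h F).trans (by simp)

theorem setLastZero_esymmEval (n : ℕ) (F : MvPolynomial ℕ ℚ) :
    setLastZero n (esymmEval (n + 1) F) = esymmEval n F := by
  have h : (setLastZero n).comp (esymmEval (n + 1)) = esymmEval n := by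
    ext1 k
    rcases k with _ | k
    · simp [esymmEval]
    · simp [esymmEval, setLastZero_esymm_succ]
  exact DFunLike.congr_fun h F

theorem setLastZero_pderiv_esymmEval (n : ℕ) (F : MvPolynomial ℕ ℚ) :
    setLastZero n (pderiv (Fin.last n) (esymmEval (n + 1) F)) =
      esymmEval n (lowerDerivation n F) := by
  have hX (k : ℕ) : setLastZero n (pderiv (Fin.last n) (esymmEval (n + 1) (X k))) =
      esymmEval n (lowerDerivation n (X k)) := by
    rcases k with _ | _ | k
    · simp [esymmEval, lowerDerivation_apply, pderiv_X]
    · rw [lowerDerivation_apply, Finset.sum_eq_zero]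
      · simp [esymmEval]
      · intro a ha
        have := Finset.mem_Icc.mp ha
        rw [zero_add, pderiv_X_of_ne (by omega), mul_zero]
    · rw [lowerDerivation_apply, pderiv_X_of_ne (by omega)]
      simp only [pderiv_X, Pi.single_apply, add_left_inj, mul_ite, mul_one, mul_zero,
        Finset.sum_ite_eq, zero_add]
      have := setLastZero_pderiv_esymm_succ n (k + 1)
      split_ifs with h
      · simp [esymmEval, this]
      · have : n < k + 1 := by simpa using h
        simp [esymmEval, setLastZero_pderiv_esymm_succ, esymm_fin_eq_zero this]
  induction F using MvPolynomial.induction_on with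
  | C a => simp [esymmEval, algebraMap_eq]
  | add p q hp hq => simp only [map_add, hp, hq]
  | mul_X p k hp =>
    simp only [map_mul, Derivation.leibniz, map_add, smul_eq_mul, hp, hX, setLastZero_esymmEval]

theorem coeff_lowerDerivation (n : ℕ) (F : MvPolynomial ℕ ℚ) (m : ℕ →₀ ℕ) :
    coeff m (lowerDerivation n F) =
      coeff (m + Finsupp.single 1 1) F * (m 1 + 1) +
        ∑ a ∈ Finset.Icc 1 n with a ∈ m.support,
          coeff (m - Finsupp.single a 1 + Finsupp.single (a + 1) 1) F * (m (a + 1) + 1) := by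
  rw [lowerDerivation_apply, coeff_add, coeff_pderiv, coeff_sum, Finset.sum_filter]
  congr 1
  refine Finset.sum_congr rfl fun a _ => ?_
  rw [coeff_X_mul', coeff_pderiv]
  simp

/-- Algebraic independence of the elementary symmetric polynomials. -/
theorem coeff_eq_zero_of_esymmEval_eq_zero {n : ℕ} {G : MvPolynomial ℕ ℚ}
    (hG : esymmEval n G = 0) {m : ℕ →₀ ℕ} (hm : ∀ k ∈ m.support, 1 ≤ k ∧ k ≤ n) :
    coeff m G = 0 := by
  let f : Fin n → ℕ := fun i => i + 1
  have hf : Function.Injective f := fun i j h => Fin.ext (Nat.succ_injective h)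
  have hrange {k : ℕ} (h1 : 1 ≤ k) (h2 : k ≤ n) : f ⟨k - 1, by omega⟩ = k := by
    simp only [f]; omega
  have hcomp : ((aeval fun i : Fin n => esymm (Fin n) ℚ (i + 1)).comp (killCompl hf)) =
      esymmEval n := by
    ext1 k
    by_cases hk : 1 ≤ k ∧ k ≤ n
    · obtain ⟨h1, h2⟩ := hk
      rw [← hrange h1 h2, AlgHom.comp_apply, ← rename_X f, killCompl_rename_app]
      simp [esymmEval, f]
    · have : k ∉ Set.range f := by
        rintro ⟨i, rfl⟩
        exact hk ⟨Nat.succ_pos _, i.2⟩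
      rw [AlgHom.comp_apply, killCompl, aeval_X, dif_neg this, map_zero, esymmEval, aeval_X]
      split_ifs with h0
      · rfl
      · exact (esymm_fin_eq_zero (by omega)).symm
  have hkill : killCompl hf G = 0 := by
    apply esymmAlgHom_fin_injective ℚ (le_refl n)
    apply Subtype.ext
    rw [map_zero, esymmAlgHom_apply]
    exact (DFunLike.congr_fun hcomp G).trans hG
  have hsub : (m.support : Set ℕ) ⊆ Set.range f := fun k hk =>
    ⟨_, hrange (hm k hk).1 (hm k hk).2⟩
  rw [← Finsupp.mapDomain_comapDomain f hf m hsub, ← coeff_killCompl hf, hkill, coeff_zero]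

theorem Multiset.finite_setOf_sum_le (d : ℕ) :
    {q : Multiset ℕ | (∀ a ∈ q, 2 ≤ a) ∧ q.sum ≤ d}.Finite := by
  refine ((Set.finite_Iic d).biUnion fun k _ =>
    Set.finite_range (Nat.Partition.parts : k.Partition → Multiset ℕ)).subset ?_
  rintro q ⟨h2, hd⟩
  simp only [Set.mem_iUnion]
  exact ⟨q.sum, hd, ⟨q, fun {i} hi => by have := h2 i hi; omega, rfl⟩, rfl⟩

theorem toFinsupp_raise_part {p : Multiset ℕ} {a : ℕ} (ha : a ∈ p) (j : ℕ) :
    Multiset.toFinsupp p + Finsupp.single 1 j - Finsupp.single a 1 + Finsupp.single (a + 1) 1 =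
      Multiset.toFinsupp ((a + 1) ::ₘ p.erase a) + Finsupp.single 1 j := by
  obtain ⟨q, rfl⟩ := Multiset.exists_cons_of_mem ha
  ext b
  simp only [Multiset.erase_cons_head, Finsupp.add_apply, Finsupp.tsub_apply,
    Multiset.toFinsupp_apply, Multiset.count_cons, Finsupp.single_apply]
  grind

/-- The amplitude of degree `d`, as a polynomial in formal variables `X k` standing for `e_k`. -/
noncomputable def formalAmplitude (C : Multiset ℕ → ℚ) (d : ℕ) : MvPolynomial ℕ ℚ :=
  ∑ q ∈ (Multiset.finite_setOf_sum_le d).toFinset,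
    monomial (Multiset.toFinsupp q + Finsupp.single 1 (d - q.sum)) (C q)

theorem esymmEval_monomial (n : ℕ) {q : Multiset ℕ} (hq : ∀ a ∈ q, 2 ≤ a) (j : ℕ) (c : ℚ) :
    esymmEval n (monomial (Multiset.toFinsupp q + Finsupp.single 1 j) c) =
      c • (esymmProd n q * esymm (Fin n) ℚ 1 ^ j) := by
  have hprod : esymmEval n (monomial (Multiset.toFinsupp q) 1) = esymmProd n q := by
    induction q using Multiset.induction_on with
    | empty => simp [esymmProd]
    | cons a q ih =>
      have ha := hq a (Multiset.mem_cons_self a q)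
      rw [← Multiset.singleton_add, map_add, Multiset.toFinsupp_singleton, ← one_mul (1 : ℚ),
        ← monomial_mul, map_mul, ih fun b hb => hq b (Multiset.mem_cons_of_mem hb)]
      rw [esymmEval, aeval_monomial, map_one, one_mul, Finsupp.prod_single_index (by simp),
        pow_one, if_neg (by omega), esymmProd, esymmProd, Multiset.singleton_add,
        Multiset.map_cons, Multiset.prod_cons]
  have hpow : esymmEval n (monomial (Finsupp.single 1 j) 1) = esymm (Fin n) ℚ 1 ^ j := by
    rw [esymmEval, aeval_monomial, map_one, one_mul, Finsupp.prod_single_index (by simp),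
      if_neg one_ne_zero]
  rw [← mul_one c, ← smul_eq_mul, ← smul_monomial, map_smul, ← one_mul (1 : ℚ), ← monomial_mul,
    map_mul, hprod, hpow]
  simp

theorem amplitudeTrunc_eq_esymmEval {g n : ℕ} (hgn : 3 ≤ 3 * g + n) {C : Multiset ℕ → ℚ}
    (hC : ∀ q, C q ≠ 0 → ∀ a ∈ q, 2 ≤ a) :
    amplitudeTrunc g n C = esymmEval n (formalAmplitude C (3 * g + n - 3)) := by
  rw [amplitudeTrunc, formalAmplitude, map_sum, finsum_eq_sum_of_support_subset
    (s := (Multiset.finite_setOf_sum_le (3 * g + n - 3)).toFinset)]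
  · refine Finset.sum_congr rfl fun q hq => ?_
    obtain ⟨h2, hd⟩ := (Set.Finite.mem_toFinset _).mp hq
    rw [if_pos (by omega), esymmEval_monomial n h2]
  · intro q hq
    rw [Function.mem_support, ite_ne_right_iff] at hq
    rw [Set.Finite.coe_toFinset]
    exact ⟨hC q (left_ne_zero_of_smul hq.2), by have := hq.1; omega⟩

theorem coeff_formalAmplitude {C : Multiset ℕ → ℚ} {d j : ℕ} {p : Multiset ℕ}
    (hp : ∀ a ∈ p, 2 ≤ a) (hd : p.sum + j = d) :
    coeff (Multiset.toFinsupp p + Finsupp.single 1 j) (formalAmplitude C d) = C p := by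
  rw [formalAmplitude, coeff_sum, Finset.sum_eq_single p]
  · rw [show d - p.sum = j by omega, coeff_monomial, if_pos rfl]
  · intro q hq hqp
    obtain ⟨h2, -⟩ := (Set.Finite.mem_toFinset _).mp hq
    rw [coeff_monomial, if_neg]
    intro h
    refine hqp (Multiset.ext.mpr fun a => ?_)
    by_cases ha : a = 1
    · subst ha
      rw [Multiset.count_eq_zero_of_notMem fun h1 => absurd (h2 1 h1) (by norm_num),
        Multiset.count_eq_zero_of_notMem fun h1 => absurd (hp 1 h1) (by norm_num)]
    · simpa [Finsupp.single_apply, Ne.symm ha] using DFunLike.congr_fun h a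
  · intro h
    refine absurd ((Set.Finite.mem_toFinset _).mpr ?_) h
    exact ⟨hp, by omega⟩

/-- The dilaton equation implies the dilaton recursion (eq:Cgdilaton) on the
coefficients `C(λ)`:
`Σ_{a ∈ distinct parts of λ} (m_{a+1}(λ)+1)·C(λ∖{a} ∪ {a+1})
 + (m_2(λ)+1)·C(λ ∪ {2}) + (g−|λ|)·C(λ) = 0`. -/
theorem dilaton_recursion (g : ℕ) (hg : 1 ≤ g) (C : Multiset ℕ → ℚ)
    (hvan : ∀ p : Multiset ℕ,
      ¬ ((∀ a ∈ p, 2 ≤ a) ∧ p.sum + 3 ≤ 3 * g + p.sup) → C p = 0)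
    (hdilaton : ∀ n, 1 ≤ n →
      setLastZero n (pderiv (Fin.last n) (amplitudeTrunc g (n + 1) C))
        = ((2 * g + n - 2 : ℕ) : ℚ) • amplitudeTrunc g n C) :
    ∀ p : Multiset ℕ, (∀ a ∈ p, 2 ≤ a) →
      (∑ a ∈ p.toFinset, ((p.count (a + 1) : ℚ) + 1) * C ((a + 1) ::ₘ p.erase a))
        + ((p.count 2 : ℚ) + 1) * C (2 ::ₘ p)
        + ((g : ℚ) - (p.sum : ℚ)) * C p = 0 := by
  intro p hp
  have hC (q : Multiset ℕ) (hq : C q ≠ 0) : ∀ a ∈ q, 2 ≤ a := by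
    by_contra h
    exact hq (hvan q fun h' => h h'.1)
  obtain ⟨n, hn⟩ : ∃ n, n = p.sum + 1 := ⟨_, rfl⟩
  obtain ⟨k, hk⟩ : ∃ k, 3 * g + n - 3 = p.sum + (k + 1) := ⟨3 * g + n - 4 - p.sum, by omega⟩
  have hdil := hdilaton n (by omega)
  rw [amplitudeTrunc_eq_esymmEval (by omega) hC, amplitudeTrunc_eq_esymmEval (by omega) hC,
    setLastZero_pderiv_esymmEval, ← map_smul, ← sub_eq_zero, ← map_sub,
    show 3 * g + (n + 1) - 3 = p.sum + (k + 2) by omega, hk] at hdil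
  have h1p : p.count 1 = 0 :=
    Multiset.count_eq_zero_of_notMem fun h => absurd (hp 1 h) (by norm_num)
  have hle {a : ℕ} (ha : a ∈ p) : a ≤ p.sum := Multiset.le_sum_of_mem ha
  have hsupp : (Multiset.toFinsupp p + Finsupp.single 1 (k + 1)).support =
      insert 1 p.toFinset := by
    ext a
    by_cases ha : a = 1 <;> simp [ha]
  have hfilter : (Finset.Icc 1 n).filter (· ∈ insert 1 p.toFinset) = insert 1 p.toFinset := by
    refine Finset.filter_mem_eq_inter.trans (Finset.inter_eq_right.mpr fun a ha => ?_)
    rw [Finset.mem_Icc]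
    rcases Finset.mem_insert.mp ha with rfl | ha
    · omega
    · have := hp a (Multiset.mem_toFinset.mp ha)
      have := hle (Multiset.mem_toFinset.mp ha)
      omega
  have key := coeff_eq_zero_of_esymmEval_eq_zero hdil
    (m := Multiset.toFinsupp p + Finsupp.single 1 (k + 1)) (by
      intro a ha
      rw [hsupp, ← hfilter] at ha
      exact Finset.mem_Icc.mp (Finset.mem_filter.mp ha).1)
  have h1 : 1 ∉ p.toFinset := by simpa using Multiset.count_eq_zero.mp h1p
  rw [coeff_sub, coeff_smul, coeff_formalAmplitude hp rfl, coeff_lowerDerivation, hsupp, hfilter,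
    Finset.sum_insert h1, add_assoc (Multiset.toFinsupp p), ← Finsupp.single_add,
    coeff_formalAmplitude hp (by omega)] at key
  have htwo : coeff (Multiset.toFinsupp p + Finsupp.single 1 (k + 1) - Finsupp.single 1 1 +
      Finsupp.single (1 + 1) 1) (formalAmplitude C (p.sum + (k + 2))) = C (2 ::ₘ p) := by
    rw [← coeff_formalAmplitude (C := C) (d := p.sum + (k + 2)) (j := k) (p := 2 ::ₘ p)
      (by simpa using hp) (by simp; omega)]
    congr 1
    ext a
    simp [Finsupp.single_apply, Multiset.count_cons]
    grind
  have hsum : ∀ a ∈ p.toFinset,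
      coeff (Multiset.toFinsupp p + Finsupp.single 1 (k + 1) - Finsupp.single a 1 +
        Finsupp.single (a + 1) 1) (formalAmplitude C (p.sum + (k + 2))) *
        (((Multiset.toFinsupp p + Finsupp.single 1 (k + 1) : ℕ →₀ ℕ) (a + 1) : ℚ) + 1) =
      ((p.count (a + 1) : ℚ) + 1) * C ((a + 1) ::ₘ p.erase a) := by
    intro a ha
    have ha' := Multiset.mem_toFinset.mp ha
    have ha2 := hp a ha'
    have hs := Multiset.sum_erase ha'
    rw [← coeff_formalAmplitude (C := C) (d := p.sum + (k + 2)) (j := k + 1)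
      (p := (a + 1) ::ₘ p.erase a)
      ?_ (by simp; omega), mul_comm]
    · congr 2
      · have ha0 : a ≠ 0 := by omega
        simp [ha0]
      · exact toFinsupp_raise_part ha' (k + 1)
    · intro b hb
      rcases Multiset.mem_cons.mp hb with rfl | hb
      · omega
      · exact hp b (Multiset.mem_of_mem_erase hb)
  rw [htwo, Finset.sum_congr rfl hsum] at key
  have hcast : ((2 * g + n - 2 : ℕ) : ℚ) = 2 * g + n - 2 := by
    rw [Nat.cast_sub (by omega)]
    push_cast
    ring
  have hkq : (k : ℚ) + 4 + p.sum = 3 * g + n := by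
    have : k + 4 + p.sum = 3 * g + n := by omega
    exact_mod_cast this
  rw [hcast] at key
  simp [h1p] at key
  linear_combination key - C p * hkq
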